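/- For all N ≥ 1, the variance of the function a−b with respect to μ_{N,1} equals ( n(n+2) + (N−1)(m+n)(m+n+2) ) / 12. -/

import Mathlib

open Finsupp Filter

noncomputable section

/-- Signed-sum convention: `signedSum c k = Σ_{i=0}^{k} c i`, which is the ordinary sum for
`k ≥ 0`, is `0` for `k = -1`, and equals `-(c (-1) + c (-2) + ⋯ + c (k+1))` for `k ≤ -2`. -/
def signedSum {M : Type*} [AddCommGroup M] (c : ℤ → M) (k : ℤ) : M :=
  (∑ i ∈ Finset.range (k + 1).toNat, c i) -
    ∑ i ∈ Finset.range (-(k + 1)).toNat, c (-((i : ℤ) + 1))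

/-- The Demazure operator `D₀` (relative to `Λ = mΛ₀ + nΛ₁`):
`D₀ δ_{(a,b)} = Σ_{i=0}^{m - 2(a-b)} δ_{(a+i,b)}`, extended ℤ-linearly. -/
def D0 (m : ℕ) (μ : ℤ × ℤ →₀ ℤ) : ℤ × ℤ →₀ ℤ :=
  μ.sum fun p c =>
    c • signedSum (fun i => Finsupp.single (p.1 + i, p.2) (1 : ℤ)) ((m : ℤ) - 2 * (p.1 - p.2))

/-- The Demazure operator `D₁` (relative to `Λ = mΛ₀ + nΛ₁`):
`D₁ δ_{(a,b)} = Σ_{i=0}^{n + 2(a-b)} δ_{(a,b+i)}`, extended ℤ-linearly. -/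
def D1 (n : ℕ) (μ : ℤ × ℤ →₀ ℤ) : ℤ × ℤ →₀ ℤ :=
  μ.sum fun p c =>
    c • signedSum (fun i => Finsupp.single (p.1, p.2 + i) (1 : ℤ)) ((n : ℤ) + 2 * (p.1 - p.2))

/-- Total mass `μ(Γ)` of a finitely supported function on `ℤ × ℤ`. -/
def mass (μ : ℤ × ℤ →₀ ℤ) : ℤ := μ.sum fun _ c => c

/-- Expected value `E_ν[f] = (1/ν(Γ)) Σ ν(a,b) f(a,b)`. -/
def expVal (ν : ℤ × ℤ →₀ ℤ) (f : ℤ × ℤ → ℚ) : ℚ :=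
  (mass ν : ℚ)⁻¹ * ν.sum fun p c => (c : ℚ) * f p

/-- Covariance `Cov_ν(f,g) = E_ν[f·g] - E_ν[f]·E_ν[g]`. -/
def cov (ν : ℤ × ℤ →₀ ℤ) (f g : ℤ × ℤ → ℚ) : ℚ :=
  expVal ν (fun p => f p * g p) - expVal ν f * expVal ν g

/-- Variance `Var_ν(f) = Cov_ν(f,f)`. -/
def var (ν : ℤ × ℤ →₀ ℤ) (f : ℤ × ℤ → ℚ) : ℚ := cov ν f f

/-- The coordinate function `a` (the degree). -/
def fa : ℤ × ℤ → ℚ := fun p => (p.1 : ℚ)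

/-- The coordinate function `b`. -/
def fb : ℤ × ℤ → ℚ := fun p => (p.2 : ℚ)

/-- The finite-weight coordinate `a - b`. -/
def fab : ℤ × ℤ → ℚ := fun p => (p.1 : ℚ) - (p.2 : ℚ)

/-- `μ_{N,0}`: start from `δ_{(0,0)}`, apply `D₀` at odd steps and `D₁` at even steps. -/
def mu0 (m n : ℕ) : ℕ → (ℤ × ℤ →₀ ℤ)
  | 0 => Finsupp.single (0, 0) 1
  | N + 1 => if N % 2 = 0 then D0 m (mu0 m n N) else D1 n (mu0 m n N)

/-- `μ_{N,1}`: start from `δ_{(0,0)}`, apply `D₁` at odd steps and `D₀` at even steps. -/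
def mu1 (m n : ℕ) : ℕ → (ℤ × ℤ →₀ ℤ)
  | 0 => Finsupp.single (0, 0) 1
  | N + 1 => if N % 2 = 0 then D1 n (mu1 m n N) else D0 m (mu1 m n N)

theorem signedSum_eq_sub {M : Type*} [AddCommGroup M] {c G : ℤ → M}
    (h : ∀ i, G (i + 1) - G i = c i) (k : ℤ) : signedSum c k = G (k + 1) - G 0 := by
  have pos (l : ℕ) : ∑ i ∈ Finset.range l, c i = G l - G 0 := by
    simpa [← h] using Finset.sum_range_sub (fun i : ℕ => G i) l
  have neg (l : ℕ) : ∑ i ∈ Finset.range l, c (-((i : ℤ) + 1)) = G 0 - G (-l) := by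
    simpa [← h] using Finset.sum_range_sub' (fun i : ℕ => G (-i)) l
  rw [signedSum, pos, neg]
  rcases le_total 0 (k + 1) with hk | hk
  · rw [Int.toNat_of_nonneg hk, Int.toNat_of_nonpos (neg_nonpos.2 hk)]
    simp
  · rw [Int.toNat_of_nonpos hk, Int.toNat_of_nonneg (neg_nonneg.2 hk)]
    simp

theorem map_signedSum {M N : Type*} [AddCommGroup M] [AddCommGroup N] (φ : M →+ N)
    (c : ℤ → M) (k : ℤ) : φ (signedSum c k) = signedSum (fun i => φ (c i)) k := by
  simp [signedSum]

section CenteredPowerSums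

variable {y : ℚ} {k : ℤ}

theorem signedSum_one (hk : (k : ℚ) = 2 * y) : signedSum (fun _ => (1 : ℚ)) k = 1 + 2 * y := by
  rw [signedSum_eq_sub (G := fun i : ℤ => (i : ℚ)) (by intro i; push_cast; ring)]
  push_cast
  rw [hk]
  ring

theorem signedSum_centered (hk : (k : ℚ) = 2 * y) :
    signedSum (fun i => y - (i : ℚ)) k = 0 := by
  rw [signedSum_eq_sub (G := fun i : ℤ => y * i - i * (i - 1) / 2) (by intro i; push_cast; ring)]
  push_cast
  rw [hk]
  ring

theorem signedSum_centered_sq (hk : (k : ℚ) = 2 * y) :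
    signedSum (fun i => (y - (i : ℚ)) ^ 2) k = y / 3 + y ^ 2 + 2 / 3 * y ^ 3 := by
  rw [signedSum_eq_sub
    (G := fun i : ℤ => y ^ 2 * i - y * (i * (i - 1)) + i * (i - 1) * (2 * i - 1) / 6)
    (by intro i; push_cast; ring)]
  push_cast
  rw [hk]
  ring

theorem signedSum_centered_cube (hk : (k : ℚ) = 2 * y) :
    signedSum (fun i => (y - (i : ℚ)) ^ 3) k = 0 := by
  rw [signedSum_eq_sub
    (G := fun i : ℤ => y ^ 3 * i - 3 * y ^ 2 * (i * (i - 1) / 2)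
      + 3 * y * (i * (i - 1) * (2 * i - 1) / 6) - (i * (i - 1) / 2) ^ 2)
    (by intro i; push_cast; ring)]
  push_cast
  rw [hk]
  ring

end CenteredPowerSums

/-- The integral of `f` against `ν`, additive in `ν`. -/
def pairing (f : ℤ × ℤ → ℚ) : (ℤ × ℤ →₀ ℤ) →+ ℚ :=
  Finsupp.liftAddHom fun p => (AddMonoidHom.mulRight (f p)).comp (Int.castAddHom ℚ)

theorem pairing_apply (f : ℤ × ℤ → ℚ) (ν : ℤ × ℤ →₀ ℤ) :
    pairing f ν = ν.sum fun p c => (c : ℚ) * f p := rfl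

@[simp]
theorem pairing_single (f : ℤ × ℤ → ℚ) (p : ℤ × ℤ) (c : ℤ) :
    pairing f (Finsupp.single p c) = c * f p := by
  simp [pairing_apply]

theorem expVal_eq_pairing (ν : ℤ × ℤ →₀ ℤ) (f : ℤ × ℤ → ℚ) :
    expVal ν f = (pairing (fun _ => 1) ν)⁻¹ * pairing f ν := by
  simp [expVal, mass, pairing_apply, Finsupp.sum]

theorem pairing_cubic (ν : ℤ × ℤ →₀ ℤ) (z : ℤ × ℤ → ℚ) (a₀ a₁ a₂ a₃ : ℚ) :
    pairing (fun p => a₀ + a₁ * z p + a₂ * z p ^ 2 + a₃ * z p ^ 3) ν =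
      a₀ * pairing (fun _ => 1) ν + a₁ * pairing z ν + a₂ * pairing (fun p => z p ^ 2) ν
        + a₃ * pairing (fun p => z p ^ 3) ν := by
  simp only [pairing_apply, Finsupp.sum, Finset.mul_sum, ← Finset.sum_add_distrib]
  exact Finset.sum_congr rfl fun p _ => by ring

/-- `ν` has mass `M` and, in the coordinate `y`, vanishing first and third moments and
normalized second moment `V`. -/
structure HasCenteredMoments (ν : ℤ × ℤ →₀ ℤ) (y : ℤ × ℤ → ℚ) (M V : ℚ) : Prop where
  mass : pairing (fun _ => 1) ν = M
  first : pairing y ν = 0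
  second : pairing (fun p => y p ^ 2) ν = M * V
  third : pairing (fun p => y p ^ 3) ν = 0

theorem HasCenteredMoments.var_eq {ν : ℤ × ℤ →₀ ℤ} {y f : ℤ × ℤ → ℚ} {M V t s : ℚ}
    (h : HasCenteredMoments ν y M V) (hM : M ≠ 0) (hs : s ^ 2 = 1)
    (hf : ∀ p, f p = t + s * y p) : var ν f = V := by
  have h₁ : pairing f ν = t * M := by
    have := pairing_cubic ν y t s 0 0
    simp only [h.mass, h.first, zero_mul, mul_zero, add_zero, ← hf] at this
    exact this
  have h₂ : pairing (fun p => f p * f p) ν = t ^ 2 * M + M * V := by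
    have := pairing_cubic ν y (t ^ 2) (2 * t * s) 1 0
    rw [h.mass, h.first, h.second, h.third] at this
    rw [show (fun p => f p * f p) =
        fun p => t ^ 2 + 2 * t * s * y p + 1 * y p ^ 2 + 0 * y p ^ 3 from
      funext fun p => by rw [hf]; linear_combination y p ^ 2 * hs, this]
    ring
  rw [var, cov, expVal_eq_pairing, expVal_eq_pairing, h₁, h₂, h.mass]
  field_simp
  ring

/-- The operator sending `δ_p` to `Σ_{i=0}^{k p} δ_{T p i}`; both Demazure operators are of this
form. -/
def stringSum (T : ℤ × ℤ → ℤ → ℤ × ℤ) (k : ℤ × ℤ → ℤ) (ν : ℤ × ℤ →₀ ℤ) : ℤ × ℤ →₀ ℤ :=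
  ν.sum fun p c => c • signedSum (fun i => Finsupp.single (T p i) (1 : ℤ)) (k p)

theorem pairing_stringSum (T : ℤ × ℤ → ℤ → ℤ × ℤ) (k : ℤ × ℤ → ℤ) (f : ℤ × ℤ → ℚ)
    (ν : ℤ × ℤ →₀ ℤ) :
    pairing f (stringSum T k ν) = pairing (fun p => signedSum (fun i => f (T p i)) (k p)) ν := by
  rw [stringSum, Finsupp.sum, map_sum, pairing_apply, Finsupp.sum]
  refine Finset.sum_congr rfl fun p _ => ?_
  rw [map_zsmul, map_signedSum, zsmul_eq_mul]
  simp

section StringSum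

variable {T : ℤ × ℤ → ℤ → ℤ × ℤ} {k : ℤ × ℤ → ℤ} {y : ℤ × ℤ → ℚ}

theorem hasCenteredMoments_stringSum (hT : ∀ p i, y (T p i) = y p - i)
    (hk : ∀ p, (k p : ℚ) = 2 * y p) {ν : ℤ × ℤ →₀ ℤ} {M V : ℚ}
    (hM : pairing (fun p => 1 + 2 * y p) ν = M)
    (hV : pairing (fun p => y p / 3 + y p ^ 2 + 2 / 3 * y p ^ 3) ν = M * V) :
    HasCenteredMoments (stringSum T k ν) y M V where
  mass := by simp only [pairing_stringSum, signedSum_one (hk _), hM]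
  first := by
    simp only [pairing_stringSum, hT, signedSum_centered (hk _)]
    simp [pairing_apply]
  second := by simp only [pairing_stringSum, hT, signedSum_centered_sq (hk _), hV]
  third := by
    simp only [pairing_stringSum, hT, signedSum_centered_cube (hk _)]
    simp [pairing_apply]

theorem HasCenteredMoments.stringSum (hT : ∀ p i, y (T p i) = y p - i)
    (hk : ∀ p, (k p : ℚ) = 2 * y p) {ν : ℤ × ℤ →₀ ℤ} {z : ℤ × ℤ → ℚ} {M V c : ℚ}
    (h : HasCenteredMoments ν z M V) (hyz : ∀ p, y p = c - z p) :
    HasCenteredMoments (stringSum T k ν) y (M * (2 * c + 1)) (V + c * (c + 1) / 3) := by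
  have key := pairing_cubic ν z
  simp only [h.mass, h.first, h.second, h.third] at key
  refine hasCenteredMoments_stringSum hT hk ?_ ?_
  · rw [show (fun p => 1 + 2 * y p) =
        fun p => (1 + 2 * c) + (-2) * z p + 0 * z p ^ 2 + 0 * z p ^ 3 from
      funext fun p => by rw [hyz]; ring, key]
    ring
  · rw [show (fun p => y p / 3 + y p ^ 2 + 2 / 3 * y p ^ 3) =
        fun p => (c / 3 + c ^ 2 + 2 / 3 * c ^ 3) + (-(1 / 3) - 2 * c - 2 * c ^ 2) * z p
          + (1 + 2 * c) * z p ^ 2 + (-(2 / 3)) * z p ^ 3 from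
      funext fun p => by rw [hyz]; ring, key]
    ring

end StringSum

/-- The coordinate in which `D₀`-strings are centered. -/
def centered0 (m : ℕ) (p : ℤ × ℤ) : ℚ := m / 2 - fab p

/-- The coordinate in which `D₁`-strings are centered. -/
def centered1 (n : ℕ) (p : ℤ × ℤ) : ℚ := n / 2 + fab p

theorem HasCenteredMoments.D0 {m n : ℕ} {ν : ℤ × ℤ →₀ ℤ} {M V : ℚ}
    (h : HasCenteredMoments ν (centered1 n) M V) :
    HasCenteredMoments (D0 m ν) (centered0 m) (M * (m + n + 1))
      (V + (m + n) * (m + n + 2) / 12) := by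
  convert h.stringSum (T := fun p i => (p.1 + i, p.2)) (k := fun p => m - 2 * (p.1 - p.2))
    (y := centered0 m) (c := (m + n) / 2) ?_ ?_ ?_ using 1
  · rfl
  · ring
  · ring
  all_goals intros; simp only [centered0, centered1, fab]; push_cast; ring

theorem HasCenteredMoments.D1 {m n : ℕ} {ν : ℤ × ℤ →₀ ℤ} {M V : ℚ}
    (h : HasCenteredMoments ν (centered0 m) M V) :
    HasCenteredMoments (D1 n ν) (centered1 n) (M * (m + n + 1))
      (V + (m + n) * (m + n + 2) / 12) := by
  convert h.stringSum (T := fun p i => (p.1, p.2 + i)) (k := fun p => n + 2 * (p.1 - p.2))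
    (y := centered1 n) (c := (m + n) / 2) ?_ ?_ ?_ using 1
  · rfl
  · ring
  · ring
  all_goals intros; simp only [centered0, centered1, fab]; push_cast; ring

theorem hasCenteredMoments_D1_single (n : ℕ) :
    HasCenteredMoments (D1 n (Finsupp.single (0, 0) 1)) (centered1 n) (n + 1)
      (n * (n + 2) / 12) := by
  refine hasCenteredMoments_stringSum (T := fun p i => (p.1, p.2 + i))
    (k := fun p => n + 2 * (p.1 - p.2)) ?_ ?_ ?_ ?_
  · intros; simp only [centered1, fab]; push_cast; ring
  · intros; simp only [centered1, fab]; push_cast; ring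
  · simp [centered1, fab]; ring
  · simp [centered1, fab]; ring

theorem hasCenteredMoments_mu1 (m n N : ℕ) :
    HasCenteredMoments (mu1 m n (N + 1)) (if N % 2 = 0 then centered1 n else centered0 m)
      ((n + 1) * (m + n + 1) ^ N) ((n * (n + 2) + N * (m + n) * (m + n + 2)) / 12) := by
  induction N with
  | zero => simpa [mu1] using hasCenteredMoments_D1_single n
  | succ N ih =>
    rw [mu1]
    rcases Nat.mod_two_eq_zero_or_one N with hN | hN
    · have hN' : (N + 1) % 2 = 1 := by lia
      simp only [hN, hN', if_true, one_ne_zero, if_false] at ih ⊢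
      convert ih.D0 (m := m) using 1 <;> push_cast <;> ring
    · have hN' : (N + 1) % 2 = 0 := by lia
      simp only [hN, hN', if_true, one_ne_zero, if_false] at ih ⊢
      convert ih.D1 (n := n) using 1 <;> push_cast <;> ring

/-- `Var_{μ_{N,1}}(a-b) = (n(n+2) + (N-1)(m+n)(m+n+2))/12` for `N ≥ 1`. -/
theorem stmt_12 (m n : ℕ) (N : ℕ) (hN : 1 ≤ N) :
    var (mu1 m n N) fab =
      ((n : ℚ) * ((n : ℚ) + 2) +
        ((N : ℚ) - 1) * ((m : ℚ) + (n : ℚ)) * ((m : ℚ) + (n : ℚ) + 2)) / 12 := by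
  obtain ⟨N, rfl⟩ := Nat.exists_eq_add_of_le' hN
  have h := hasCenteredMoments_mu1 m n N
  have hM : ((n : ℚ) + 1) * ((m : ℚ) + n + 1) ^ N ≠ 0 := by positivity
  rw [Nat.cast_add, Nat.cast_one, add_sub_cancel_right]
  split_ifs at h
  · exact h.var_eq hM (t := -(n / 2)) (s := 1) (by norm_num)
      fun p => by simp only [centered1]; ring
  · exact h.var_eq hM (t := m / 2) (s := -1) (by norm_num)
      fun p => by simp only [centered0]; ring
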